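/- arXiv:1801.03773 — 2 statements merged into one kernel-verified Lean document; each statement's English description precedes it below -/
import Mathlib

section
/- Let ι be a finite index type, let E i (for i : ι) be finite-dimensional real inner product spaces, let z : Π i, E i, and let λ ≥ 0 be a real number. Define x₀ : Π i, E i by x₀ i = (1 − λ/‖z i‖)₊ • (z i) when z i ≠ 0 and x₀ i = 0 when z i = 0, where (t)₊ = max t 0. Then x₀ minimizes the group lasso objective: for every x : Π i, E i, (1/2)·∑_i ‖z i − x₀ i‖² + λ·∑_i ‖x₀ i‖ ≤ (1/2)·∑_i ‖z i − x i‖² + λ·∑_i ‖x i‖. -/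
open scoped Classical

/-- Block soft-thresholding minimizes `x ↦ ‖z - x‖ ^ 2 / 2 + lam * ‖x‖`. -/
theorem blockSoftThreshold_minimizes {F : Type*} [NormedAddCommGroup F] [NormedSpace ℝ F]
    (z x : F) {lam : ℝ} (hlam : 0 ≤ lam) :
    (1 / 2) * ‖z - (if z = 0 then 0 else (max (1 - lam / ‖z‖) 0) • z)‖ ^ 2 +
        lam * ‖(if z = 0 then 0 else (max (1 - lam / ‖z‖) 0) • z)‖ ≤
      (1 / 2) * ‖z - x‖ ^ 2 + lam * ‖x‖ := by
  split_ifs with hz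
  · subst hz
    have hright : 0 ≤ (1 / 2) * ‖0 - x‖ ^ 2 + lam * ‖x‖ := by positivity
    simpa using hright
  have ha : 0 < ‖z‖ := norm_pos_iff.mpr hz
  have hx : 0 ≤ ‖x‖ := norm_nonneg x
  have hsq : (‖z‖ - ‖x‖) ^ 2 ≤ ‖z - x‖ ^ 2 :=
    sq_le_sq.mpr ((abs_norm_sub_norm_le z x).trans (le_abs_self _))
  rcases le_total lam ‖z‖ with h | h
  · have hc : 0 ≤ 1 - lam / ‖z‖ := sub_nonneg.mpr ((div_le_one ha).mpr h)
    have hsub : z - (1 - lam / ‖z‖) • z = (lam / ‖z‖) • z := by module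
    rw [max_eq_left hc, hsub, norm_smul_of_nonneg (by positivity), norm_smul_of_nonneg hc,
      sub_mul, div_mul_cancel₀ _ ha.ne']
    nlinarith [sq_nonneg (‖z‖ - ‖x‖ - lam)]
  · have hc : 1 - lam / ‖z‖ ≤ 0 := sub_nonpos.mpr ((one_le_div ha).mpr h)
    simp only [max_eq_right hc, zero_smul, sub_zero, norm_zero]
    nlinarith [mul_nonneg hx (sub_nonneg.mpr h), sq_nonneg ‖x‖]

theorem group_lasso_prox_minimizes {ι : Type*} [Fintype ι]
    (E : ι → Type*) [∀ i, NormedAddCommGroup (E i)] [∀ i, InnerProductSpace ℝ (E i)]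
    [∀ i, FiniteDimensional ℝ (E i)]
    (z : ∀ i, E i) (lam : ℝ) (hlam : 0 ≤ lam)
    (x₀ : ∀ i, E i)
    (hx₀ : ∀ i, x₀ i = if z i = 0 then 0 else (max (1 - lam / ‖z i‖) 0) • z i) :
    ∀ x : ∀ i, E i,
      (1 / 2) * ∑ i, ‖z i - x₀ i‖ ^ 2 + lam * ∑ i, ‖x₀ i‖ ≤
        (1 / 2) * ∑ i, ‖z i - x i‖ ^ 2 + lam * ∑ i, ‖x i‖ := by
  intro x
  simp only [Finset.mul_sum, ← Finset.sum_add_distrib]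
  refine Finset.sum_le_sum fun i _ => ?_
  rw [hx₀ i]
  exact blockSoftThreshold_minimizes (z i) (x i) hlam
end

section
/- Let n, l, m be positive natural numbers, λ ≥ 0 a real number, and Z an l×m matrix with entries in the polar n-complex algebra K_n (Z : Matrix (Fin l) (Fin m) (ZMod n → ℝ)). Define X₀ entrywise by X₀ i k = (1 − λ/|Z i k|)₊ • (Z i k) when Z i k ≠ 0 and X₀ i k = 0 otherwise, where the modulus of a ∈ K_n is |a| = sqrt(∑_s a(s)²) and (t)₊ = max t 0. Then X₀ minimizes the entrywise ℓ1-regularized objective: for every X : Matrix (Fin l) (Fin m) (ZMod n → ℝ), (1/2)·∑_{i,k,s} (Z i k s − X₀ i k s)² + λ·∑_{i,k} |X₀ i k| ≤ (1/2)·∑_{i,k,s} (Z i k s − X i k s)² + λ·∑_{i,k} |X i k|. -/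
open scoped Classical

/-- The modulus of a polar `n`-complex number: `|a| = sqrt (∑ s, a(s)²)`. -/
noncomputable def modK {n : ℕ} [NeZero n] (a : ZMod n → ℝ) : ℝ :=
  Real.sqrt (∑ s : ZMod n, a s ^ 2)

section Modulus

variable {n : ℕ} [NeZero n]

lemma modK_nonneg (a : ZMod n → ℝ) : 0 ≤ modK a := Real.sqrt_nonneg _

lemma modK_sq (a : ZMod n → ℝ) : modK a ^ 2 = ∑ s, a s ^ 2 :=
  Real.sq_sqrt (Finset.sum_nonneg fun s _ => sq_nonneg (a s))

@[simp]
lemma modK_zero : modK (0 : ZMod n → ℝ) = 0 := by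
  simp [modK]

lemma modK_pos {a : ZMod n → ℝ} (ha : a ≠ 0) : 0 < modK a := by
  obtain ⟨s, hs⟩ := Function.ne_iff.mp ha
  exact Real.sqrt_pos.mpr (Finset.sum_pos' (fun t _ => sq_nonneg (a t))
    ⟨s, Finset.mem_univ s, sq_pos_of_ne_zero hs⟩)

lemma modK_smul {c : ℝ} (hc : 0 ≤ c) (a : ZMod n → ℝ) : modK (c • a) = c * modK a := by
  simp only [modK, Pi.smul_apply, smul_eq_mul, mul_pow, ← Finset.mul_sum]
  rw [Real.sqrt_mul (sq_nonneg c), Real.sqrt_sq hc]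

/-- The reverse triangle inequality for the modulus, in squared form. -/
lemma sq_modK_sub_modK_le (a b : ZMod n → ℝ) :
    (modK a - modK b) ^ 2 ≤ ∑ s, (a s - b s) ^ 2 := by
  have hcs : ∑ s, a s * b s ≤ modK a * modK b :=
    Real.sum_mul_le_sqrt_mul_sqrt Finset.univ a b
  have hexp : ∑ s, (a s - b s) ^ 2 = modK a ^ 2 - 2 * ∑ s, a s * b s + modK b ^ 2 := by
    rw [modK_sq, modK_sq, Finset.mul_sum, ← Finset.sum_sub_distrib, ← Finset.sum_add_distrib]
    exact Finset.sum_congr rfl fun s _ => by ring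
  rw [hexp]
  linarith [sub_sq (modK a) (modK b)]

/-- Scalar soft thresholding minimizes the one-dimensional `ℓ1`-regularized objective. -/
lemma soft_threshold_minimizes {lam r q : ℝ} (hr : 0 < r) (hq : 0 ≤ q) :
    (1 / 2) * ((1 - max (1 - lam / r) 0) ^ 2 * r ^ 2) + lam * (max (1 - lam / r) 0 * r) ≤
      (1 / 2) * (r - q) ^ 2 + lam * q := by
  rcases le_total lam r with h | h
  · rw [max_eq_left (sub_nonneg.mpr ((div_le_one hr).mpr h))]
    have hlhs : (1 / 2) * ((1 - (1 - lam / r)) ^ 2 * r ^ 2) + lam * ((1 - lam / r) * r) =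
        (1 / 2) * lam ^ 2 + lam * (r - lam) := by
      field_simp
      ring
    rw [hlhs]
    linarith [sq_nonneg (r - q - lam), show (r - q - lam) ^ 2 =
      (r - q) ^ 2 - 2 * lam * (r - q) + lam ^ 2 by ring]
  · rw [max_eq_right (sub_nonpos.mpr ((one_le_div hr).mpr h))]
    nlinarith [mul_nonneg (sub_nonneg.mpr h) hq, sq_nonneg q]

/-- Soft thresholding of the modulus minimizes the `ℓ1`-regularized objective of one entry. -/
lemma modK_prox_minimizes {lam : ℝ} (hlam : 0 ≤ lam) (z x : ZMod n → ℝ) {x₀ : ZMod n → ℝ}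
    (hx₀ : x₀ = if z = 0 then 0 else (max (1 - lam / modK z) 0) • z) :
    (1 / 2) * (∑ s, (z s - x₀ s) ^ 2) + lam * modK x₀ ≤
      (1 / 2) * (∑ s, (z s - x s) ^ 2) + lam * modK x := by
  subst hx₀
  split_ifs with hz
  · subst hz
    simp only [Pi.zero_apply, sub_self, modK_zero, mul_zero, add_zero, ne_eq, OfNat.ofNat_ne_zero,
      not_false_eq_true, zero_pow, Finset.sum_const_zero]
    have := mul_nonneg hlam (modK_nonneg x)
    positivity
  · have hdist (c : ℝ) : ∑ s, (z s - (c • z) s) ^ 2 = (1 - c) ^ 2 * modK z ^ 2 := by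
      rw [modK_sq, Finset.mul_sum]
      exact Finset.sum_congr rfl fun s _ => by simp only [Pi.smul_apply, smul_eq_mul]; ring
    rw [hdist, modK_smul (le_max_right _ _)]
    linarith [soft_threshold_minimizes (lam := lam) (modK_pos hz) (modK_nonneg x),
      sq_modK_sub_modK_le z x]

end Modulus

theorem entrywise_l1_prox_minimizes {n l m : ℕ} [NeZero n] (hl : 0 < l) (hm : 0 < m)
    (lam : ℝ) (hlam : 0 ≤ lam)
    (Z : Matrix (Fin l) (Fin m) (ZMod n → ℝ))
    (X₀ : Matrix (Fin l) (Fin m) (ZMod n → ℝ))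
    (hX₀ : ∀ i k, X₀ i k =
      if Z i k = 0 then 0 else (max (1 - lam / modK (Z i k)) 0) • Z i k) :
    ∀ X : Matrix (Fin l) (Fin m) (ZMod n → ℝ),
      (1 / 2) * (∑ i, ∑ k, ∑ s, (Z i k s - X₀ i k s) ^ 2) + lam * ∑ i, ∑ k, modK (X₀ i k) ≤
        (1 / 2) * (∑ i, ∑ k, ∑ s, (Z i k s - X i k s) ^ 2) + lam * ∑ i, ∑ k, modK (X i k) := by
  intro X
  simp only [Finset.mul_sum (s := (Finset.univ : Finset (Fin l))),
    Finset.mul_sum (s := (Finset.univ : Finset (Fin m))), ← Finset.sum_add_distrib]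
  exact Finset.sum_le_sum fun i _ => Finset.sum_le_sum fun k _ =>
    modK_prox_minimizes hlam (Z i k) (X i k) (hX₀ i k)
end
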